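/- If ζ = q₀q₁⋯q_{m−1} is not a root of unity in k, then the graded center Z_gr(E(Γ_q)) equals k (the scalars). -/

import Mathlib

/-- Generators of the path algebra of the quiver `Q'`: idempotents `e v` for the vertices
(`some i` for `0 ≤ i ≤ m−1`, `none` for the extra vertex `−1`), and arrows
`a i : i → i+1`, `b i : i+1 → i`, `c i : i → −1`. -/
inductive GenA (m : ℕ) : Type
  | e : Option (ZMod m) → GenA m
  | a : ZMod m → GenA m
  | b : ZMod m → GenA m
  | c : ZMod m → GenA m

variable (k : Type) [Field k] (m : ℕ) [NeZero m] (q : ZMod m → k)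

open FreeAlgebra in
/-- Relations presenting the Koszul dual `E(Γ_q)` as a quotient of the free algebra on the
generators: the path-algebra relations for the quiver `Q'` together with
`q_i⁻¹ a_i b_i + b_{i−1} a_{i−1} = 0` and `b_i c_i = 0` (paths composed left to right). -/
inductive ERel : FreeAlgebra k (GenA m) → FreeAlgebra k (GenA m) → Prop
  | vert (v w : Option (ZMod m)) :
      ERel (ι k (GenA.e v) * ι k (GenA.e w)) (if v = w then ι k (GenA.e v) else 0)
  | unit : ERel (∑ v : Option (ZMod m), ι k (GenA.e v)) 1
  | srcA (i : ZMod m) : ERel (ι k (GenA.e (some i)) * ι k (GenA.a i)) (ι k (GenA.a i))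
  | tgtA (i : ZMod m) : ERel (ι k (GenA.a i) * ι k (GenA.e (some (i+1)))) (ι k (GenA.a i))
  | srcB (i : ZMod m) : ERel (ι k (GenA.e (some (i+1))) * ι k (GenA.b i)) (ι k (GenA.b i))
  | tgtB (i : ZMod m) : ERel (ι k (GenA.b i) * ι k (GenA.e (some i))) (ι k (GenA.b i))
  | srcC (i : ZMod m) : ERel (ι k (GenA.e (some i)) * ι k (GenA.c i)) (ι k (GenA.c i))
  | tgtC (i : ZMod m) : ERel (ι k (GenA.c i) * ι k (GenA.e none)) (ι k (GenA.c i))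
  | relAB (i : ZMod m) :
      ERel ((q i)⁻¹ • (ι k (GenA.a i) * ι k (GenA.b i)) +
        ι k (GenA.b (i-1)) * ι k (GenA.a (i-1))) 0
  | relBC (i : ZMod m) : ERel (ι k (GenA.b i) * ι k (GenA.c i)) 0

/-- The Koszul dual `E(Γ_q)`. -/
abbrev EΓ : Type := RingQuot (ERel k m q)

/-- The image of a generator in `E(Γ_q)`. -/
noncomputable def gE (g : GenA m) : EΓ k m q :=
  RingQuot.mkAlgHom k (ERel k m q) (FreeAlgebra.ι k g)

/-- Arrows, labelled by `Fin 3`: `0 ↦ a i`, `1 ↦ b i`, `2 ↦ c i`. -/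
def arrA (p : ZMod m × Fin 3) : GenA m :=
  if p.2 = 0 then GenA.a p.1 else if p.2 = 1 then GenA.b p.1 else GenA.c p.1

/-- The length-`l` homogeneous component of `E(Γ_q)` (the span of the paths of length `l`). -/
noncomputable def HboxA (l : ℕ) : Submodule k (EΓ k m q) :=
  Submodule.span k
    {x | ∃ (v : Option (ZMod m)) (L : List (ZMod m × Fin 3)), L.length = l ∧
      x = gE k m q (GenA.e v) * (L.map fun p => gE k m q (arrA m p)).prod}

/-- The graded centre `Z_gr(E(Γ_q))`: the subalgebra generated (equivalently, spanned) by the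
length-homogeneous elements `z` with `z y = (−1)^{|z||y|} y z` for all length-homogeneous `y`. -/
noncomputable def ZgrA : Subalgebra k (EΓ k m q) :=
  Algebra.adjoin k
    {z | ∃ l : ℕ, z ∈ HboxA k m q l ∧
      ∀ (l' : ℕ) (y : EΓ k m q), y ∈ HboxA k m q l' →
        z * y = ((-1 : k) ^ (l * l')) • (y * z)}


namespace KoszulDual

/-- Indices for the normal-form basis of `E(Γ_q)`: `ab i s t` is the path `a^s b^t` starting at
`i`, `ac i s` is the path `a^s c` starting at `i`, and `pt` is the idempotent at `−1`. -/
inductive NF (m : ℕ) : Type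
  | ab : ZMod m → ℕ → ℕ → NF m
  | ac : ZMod m → ℕ → NF m
  | pt : NF m

noncomputable instance (m : ℕ) : DecidableEq (NF m) := Classical.decEq _

section

variable {k : Type} [Field k] {m : ℕ} (q : ZMod m → k)

/-- The scalar with `b_i a^s = coef i s • a^s b`. -/
def coef : ZMod m → ℕ → k
  | _, 0 => 1
  | i, s + 1 => -(q (i + 1))⁻¹ * coef (i + 1) s

lemma coef_succ (i : ZMod m) (s : ℕ) :
    coef q i (s + 1) = coef q i s * -(q (i + s + 1))⁻¹ := by
  induction s generalizing i with
  | zero => simp [coef]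
  | succ s ih =>
    rw [coef, ih, coef, Nat.cast_succ, show i + 1 + (s : ZMod m) + 1 = i + (s + 1) + 1 by ring]
    ring

lemma coef_mul_coef_succ {i j : ZMod m} {s t : ℕ} (h : i + s = j + t) :
    coef q j t * coef q i (s + 1) = coef q i s * coef q j (t + 1) := by
  rw [coef_succ, coef_succ, h]
  ring

lemma prod_coef [NeZero m] (t : ℕ) :
    ∏ i, coef q i t = ((-1) ^ m * (∏ i, q i)⁻¹) ^ t := by
  have shift (g : ZMod m → k) : ∏ i, g (i + 1) = ∏ i, g i :=
    Equiv.prod_comp (Equiv.addRight (1 : ZMod m)) g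
  induction t with
  | zero => simp [coef]
  | succ t ih =>
    simp only [coef]
    rw [Finset.prod_mul_distrib, shift fun i => coef q i t, ih, shift fun i => -(q i)⁻¹,
      Finset.prod_neg, Finset.prod_inv_distrib, pow_succ']
    simp [ZMod.card]

/-- Left multiplication by a generator on normal forms. -/
noncomputable def leftOp : GenA m → NF m → (NF m →₀ k)
  | .e (some j), .ab i s t => if i = j then Finsupp.single (.ab i s t) 1 else 0
  | .e (some j), .ac i s => if i = j then Finsupp.single (.ac i s) 1 else 0
  | .e none, .pt => Finsupp.single .pt 1
  | .a j, .ab i s t => if i = j + 1 then Finsupp.single (.ab j (s + 1) t) 1 else 0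
  | .a j, .ac i s => if i = j + 1 then Finsupp.single (.ac j (s + 1)) 1 else 0
  | .b j, .ab i s t => if i = j then Finsupp.single (.ab (j + 1) s (t + 1)) (coef q i s) else 0
  | .c j, .pt => Finsupp.single (.ac j 0) 1
  | _, _ => 0

/-- Right multiplication by `a_j` on normal forms. -/
noncomputable def rightA (j : ZMod m) : NF m → (NF m →₀ k)
  | .ab i s t => if i + s = j + t then Finsupp.single (.ab i (s + 1) t) (coef q j t) else 0
  | _ => 0

/-- Right multiplication by `c_j` on normal forms. -/
noncomputable def rightC (j : ZMod m) : NF m → (NF m →₀ k)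
  | .ab i s 0 => if i + s = j then Finsupp.single (.ac i s) 1 else 0
  | _ => 0

/-- Left multiplication by a generator as an endomorphism of the normal-form module. -/
noncomputable def leftEnd (g : GenA m) : Module.End k (NF m →₀ k) :=
  Finsupp.linearCombination k (leftOp q g)

/-- The normal form of `1`. -/
noncomputable def oneVec [NeZero m] : NF m →₀ k :=
  ∑ i, Finsupp.single (.ab i 0 0) 1 + Finsupp.single .pt 1

@[simp] lemma leftEnd_single (g : GenA m) (n : NF m) (r : k) :
    leftEnd q g (Finsupp.single n r) = r • leftOp q g n := by
  simp [leftEnd]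

lemma lift_rel [NeZero m] ⦃x y : FreeAlgebra k (GenA m)⦄ (h : ERel k m q x y) :
    FreeAlgebra.lift k (leftEnd q) x = FreeAlgebra.lift k (leftEnd q) y := by
  induction h with
  | vert v w =>
    rcases v with _ | v <;> rcases w with _ | w <;> refine Finsupp.lhom_ext' fun n => ?_ <;>
      refine LinearMap.ext_ring ?_ <;> rcases n with ⟨i, s, t⟩ | ⟨i, s⟩ | _ <;>
      simp [leftOp] <;> split_ifs <;> simp_all [leftOp, eq_comm]
  | unit =>
    refine Finsupp.lhom_ext' fun n => LinearMap.ext_ring ?_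
    rcases n with ⟨i, s, t⟩ | ⟨i, s⟩ | _ <;> simp [leftOp, Fintype.sum_option]
  | relAB i =>
    refine Finsupp.lhom_ext' fun n => LinearMap.ext_ring ?_
    rcases n with ⟨j, s, t⟩ | ⟨j, s⟩ | _
    · by_cases h : j = i <;> simp [leftOp, h, coef]
    · by_cases h : j = i <;> simp [leftOp, h]
    · simp [leftOp]
  | _ i =>
    refine Finsupp.lhom_ext' fun n => LinearMap.ext_ring ?_
    rcases n with ⟨j, s, t⟩ | ⟨j, s⟩ | _ <;> simp [leftOp] <;> split_ifs <;> simp [leftOp, *]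

/-- The left regular representation of `E(Γ_q)` on normal forms. -/
noncomputable def rep [NeZero m] : EΓ k m q →ₐ[k] Module.End k (NF m →₀ k) :=
  RingQuot.liftAlgHom k ⟨FreeAlgebra.lift k (leftEnd q), lift_rel q⟩

@[simp] lemma rep_gE [NeZero m] (g : GenA m) : rep q (gE k m q g) = leftEnd q g := by
  simp [rep, gE]

lemma EΓ_induction [NeZero m] {P : EΓ k m q → Prop} (halg : ∀ r, P (algebraMap k _ r))
    (hgen : ∀ g, P (gE k m q g)) (hmul : ∀ x y, P x → P y → P (x * y))
    (hadd : ∀ x y, P x → P y → P (x + y)) (x : EΓ k m q) : P x := by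
  obtain ⟨x, rfl⟩ := RingQuot.mkAlgHom_surjective k (ERel k m q) x
  induction x using FreeAlgebra.induction with
  | grade0 r => simpa using halg r
  | grade1 g => exact hgen g
  | mul x y hx hy => simpa using hmul _ _ hx hy
  | add x y hx hy => simpa using hadd _ _ hx hy

/-- An endomorphism commuting with left multiplication by generators commutes with `rep`. -/
lemma commute_rep [NeZero m] (T : Module.End k (NF m →₀ k)) (hT : ∀ g, Commute (leftEnd q g) T)
    (x : EΓ k m q) : Commute (rep q x) T := by
  induction x using EΓ_induction with
  | halg r => simpa using Algebra.commute_algebraMap_left r T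
  | hgen g => simpa using hT g
  | hmul x y hx hy => simpa using hx.mul_left hy
  | hadd x y hx hy => simpa using hx.add_left hy

lemma commute_rightA (j : ZMod m) (g : GenA m) :
    Commute (leftEnd q g) (Finsupp.linearCombination k (rightA q j)) := by
  refine Finsupp.lhom_ext' fun n => LinearMap.ext_ring ?_
  rcases g with (_ | v) | v | v | v <;> rcases n with ⟨i, s, t⟩ | ⟨i, s⟩ | _ <;>
    simp [leftOp, rightA] <;> split_ifs <;>
    simp [leftOp, rightA, -Finsupp.single_mul, *] <;> grind [coef_mul_coef_succ]

lemma commute_rightC (j : ZMod m) (g : GenA m) :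
    Commute (leftEnd q g) (Finsupp.linearCombination k (rightC j)) := by
  refine Finsupp.lhom_ext' fun n => LinearMap.ext_ring ?_
  rcases g with (_ | v) | v | v | v <;> rcases n with ⟨i, s, _ | t⟩ | ⟨i, s⟩ | _ <;>
    simp [leftOp, rightC] <;> split_ifs <;>
    simp [leftOp, rightC, *] <;> grind

lemma leftEnd_a_ab (v : NF m →₀ k) (j : ZMod m) (s t : ℕ) :
    leftEnd q (.a j) v (.ab j (s + 1) t) = v (.ab (j + 1) s t) := by
  induction v using Finsupp.induction_linear with
  | zero => simp
  | add v w hv hw => simp [hv, hw]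
  | single n r =>
    rcases n with ⟨i, s', t'⟩ | ⟨i, s'⟩ | _ <;> simp [leftOp] <;> split_ifs <;>
      simp_all [Finsupp.single_apply]

lemma leftEnd_a_ac (v : NF m →₀ k) (j : ZMod m) (s : ℕ) :
    leftEnd q (.a j) v (.ac j (s + 1)) = v (.ac (j + 1) s) := by
  induction v using Finsupp.induction_linear with
  | zero => simp
  | add v w hv hw => simp [hv, hw]
  | single n r =>
    rcases n with ⟨i, s', t'⟩ | ⟨i, s'⟩ | _ <;> simp [leftOp] <;> split_ifs <;>
      simp_all [Finsupp.single_apply]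

lemma leftEnd_c_ac (v : NF m →₀ k) (i j : ZMod m) (s : ℕ) :
    leftEnd q (.c j) v (.ac i s) = if i = j ∧ s = 0 then v .pt else 0 := by
  induction v using Finsupp.induction_linear with
  | zero => simp
  | add v w hv hw => simp only [map_add, Finsupp.add_apply, hv, hw]; split_ifs <;> simp
  | single n r =>
    rcases n with ⟨i, s', t'⟩ | ⟨i, s'⟩ | _ <;>
      simp [leftOp, Finsupp.single_apply, eq_comm]

lemma leftEnd_e_pt (v : NF m →₀ k) (w : Option (ZMod m)) :
    leftEnd q (.e w) v .pt = if w = none then v .pt else 0 := by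
  induction v using Finsupp.induction_linear with
  | zero => simp
  | add v w hv hw => simp only [map_add, Finsupp.add_apply, hv, hw]; split_ifs <;> simp
  | single n r =>
    rcases w with _ | w <;> rcases n with ⟨i, s, t⟩ | ⟨i, s⟩ | _ <;> simp [leftOp] <;>
      split_ifs <;> simp

lemma leftEnd_arrA_pt (v : NF m →₀ k) (p : ZMod m × Fin 3) :
    leftEnd q (arrA m p) v .pt = 0 := by
  induction v using Finsupp.induction_linear with
  | zero => simp
  | add v w hv hw => simp [hv, hw]
  | single n r =>
    obtain ⟨j, c⟩ := p
    fin_cases c <;> rcases n with ⟨i, s, t⟩ | ⟨i, s⟩ | _ <;> simp [leftOp, arrA] <;>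
      split_ifs <;> simp

lemma rightA_ab (v : NF m →₀ k) (j : ZMod m) (s t : ℕ) :
    Finsupp.linearCombination k (rightA q j) v (.ab j (s + 1) t) =
      if (s : ZMod m) = t then coef q j t * v (.ab j s t) else 0 := by
  induction v using Finsupp.induction_linear with
  | zero => simp
  | add v w hv hw =>
    simp only [map_add, Finsupp.add_apply, hv, hw]; split_ifs <;> simp [mul_add]
  | single n r =>
    rcases n with ⟨i, s', t'⟩ | ⟨i, s'⟩ | _ <;> simp [rightA] <;> split_ifs <;>
      simp [Finsupp.single_apply] <;> grind

lemma rightA_ac (v : NF m →₀ k) (i j : ZMod m) (s : ℕ) :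
    Finsupp.linearCombination k (rightA q j) v (.ac i s) = 0 := by
  induction v using Finsupp.induction_linear with
  | zero => simp
  | add v w hv hw => simp [hv, hw]
  | single n r =>
    rcases n with ⟨i, s', t'⟩ | ⟨i, s'⟩ | _ <;> simp [rightA] <;> split_ifs <;> simp

lemma rightC_ac (v : NF m →₀ k) (i : ZMod m) (s : ℕ) :
    Finsupp.linearCombination k (rightC (i + (s : ZMod m))) v (.ac i s) = v (.ab i s 0) := by
  induction v using Finsupp.induction_linear with
  | zero => simp
  | add v w hv hw => simp [hv, hw]
  | single n r =>
    rcases n with ⟨i, s', _ | t'⟩ | ⟨i, s'⟩ | _ <;> simp [rightC] <;> split_ifs <;>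
      simp [Finsupp.single_apply] <;> grind

end

section

variable {k : Type} [Field k] {m : ℕ} [NeZero m] (q : ZMod m → k)

/-- The path `b^t` starting at `i`. -/
noncomputable def pathB : ZMod m → ℕ → EΓ k m q
  | i, 0 => gE k m q (.e (some i))
  | i, t + 1 => gE k m q (.b (i - 1)) * pathB (i - 1) t

/-- The path `a^s b^t` starting at `i`. -/
noncomputable def pathAB : ZMod m → ℕ → ℕ → EΓ k m q
  | i, 0, t => pathB q i t
  | i, s + 1, t => gE k m q (.a i) * pathAB (i + 1) s t

/-- The path `a^s c` starting at `i`. -/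
noncomputable def pathAC : ZMod m → ℕ → EΓ k m q
  | i, 0 => gE k m q (.c i)
  | i, s + 1 => gE k m q (.a i) * pathAC (i + 1) s

/-- The path in `E(Γ_q)` with a given normal form. -/
noncomputable def path : NF m → EΓ k m q
  | .ab i s t => pathAB q i s t
  | .ac i s => pathAC q i s
  | .pt => gE k m q (.e none)

lemma e_mul_e (v w : Option (ZMod m)) :
    gE k m q (.e v) * gE k m q (.e w) = if v = w then gE k m q (.e v) else 0 := by
  have h := RingQuot.mkAlgHom_rel k (ERel.vert (q := q) v w)
  split_ifs at h ⊢ <;> simpa [gE] using h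

lemma sum_e : ∑ v, gE k m q (.e v) = 1 := by
  simpa [gE] using RingQuot.mkAlgHom_rel k (ERel.unit (k := k) (q := q))

lemma e_mul_a (i : ZMod m) : gE k m q (.e (some i)) * gE k m q (.a i) = gE k m q (.a i) := by
  simpa [gE] using RingQuot.mkAlgHom_rel k (ERel.srcA (q := q) i)

lemma a_mul_e (i : ZMod m) :
    gE k m q (.a i) * gE k m q (.e (some (i + 1))) = gE k m q (.a i) := by
  simpa [gE] using RingQuot.mkAlgHom_rel k (ERel.tgtA (q := q) i)

lemma e_mul_b (i : ZMod m) :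
    gE k m q (.e (some (i + 1))) * gE k m q (.b i) = gE k m q (.b i) := by
  simpa [gE] using RingQuot.mkAlgHom_rel k (ERel.srcB (q := q) i)

lemma b_mul_e (i : ZMod m) : gE k m q (.b i) * gE k m q (.e (some i)) = gE k m q (.b i) := by
  simpa [gE] using RingQuot.mkAlgHom_rel k (ERel.tgtB (q := q) i)

lemma e_mul_c (i : ZMod m) : gE k m q (.e (some i)) * gE k m q (.c i) = gE k m q (.c i) := by
  simpa [gE] using RingQuot.mkAlgHom_rel k (ERel.srcC (q := q) i)

lemma c_mul_e (i : ZMod m) : gE k m q (.c i) * gE k m q (.e none) = gE k m q (.c i) := by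
  simpa [gE] using RingQuot.mkAlgHom_rel k (ERel.tgtC (q := q) i)

lemma b_mul_c (i : ZMod m) : gE k m q (.b i) * gE k m q (.c i) = 0 := by
  simpa [gE] using RingQuot.mkAlgHom_rel k (ERel.relBC (q := q) i)

lemma b_mul_a (i : ZMod m) : gE k m q (.b i) * gE k m q (.a i) =
    (-(q (i + 1))⁻¹) • (gE k m q (.a (i + 1)) * gE k m q (.b (i + 1))) := by
  have h := RingQuot.mkAlgHom_rel k (ERel.relAB (q := q) (i + 1))
  rw [add_sub_cancel_right] at h
  refine (eq_neg_of_add_eq_zero_right ?_).trans (neg_smul _ _).symm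
  simpa [gE] using h

/-- The starting vertex of a path. -/
def source : NF m → Option (ZMod m)
  | .ab i _ _ => some i
  | .ac i _ => some i
  | .pt => none

lemma e_mul_path (n : NF m) : gE k m q (.e (source n)) * path q n = path q n := by
  rcases n with ⟨i, _ | s, _ | t⟩ | ⟨i, _ | s⟩ | _
  · simp [source, path, pathAB, pathB, e_mul_e]
  · have h := e_mul_b q (i - 1)
    rw [sub_add_cancel] at h
    simp [source, path, pathAB, pathB, ← mul_assoc, h]
  all_goals simp [source, path, pathAB, pathAC, e_mul_e, e_mul_c, ← mul_assoc, e_mul_a]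

lemma mul_path_of_ne {x : EΓ k m q} {v : Option (ZMod m)} {n : NF m}
    (hx : x * gE k m q (.e v) = x) (h : source n ≠ v) : x * path q n = 0 := by
  rw [← hx, ← e_mul_path, mul_assoc, ← mul_assoc (gE k m q (.e v)), e_mul_e, if_neg h.symm]
  simp

lemma b_mul_pathAB (i : ZMod m) (s t : ℕ) :
    gE k m q (.b i) * pathAB q i s t = coef q i s • pathAB q (i + 1) s (t + 1) := by
  induction s generalizing i with
  | zero => simp [pathAB, pathB, coef]
  | succ s ih =>
    simp only [pathAB, coef]
    rw [← mul_assoc, b_mul_a, smul_mul_assoc, mul_assoc, ih, mul_smul_comm, smul_smul]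

lemma b_mul_pathAC (i : ZMod m) (s : ℕ) : gE k m q (.b i) * pathAC q i s = 0 := by
  induction s generalizing i with
  | zero => exact b_mul_c q i
  | succ s ih => rw [pathAC, ← mul_assoc, b_mul_a, smul_mul_assoc, mul_assoc, ih]; simp

/-- The linear map sending each normal form to the corresponding path. -/
noncomputable def eval : (NF m →₀ k) →ₗ[k] EΓ k m q := Finsupp.linearCombination k (path q)

@[simp] lemma eval_single (n : NF m) (r : k) : eval q (Finsupp.single n r) = r • path q n := by
  simp [eval]

lemma eval_oneVec : eval q oneVec = 1 := by
  rw [← sum_e q, Fintype.sum_option, add_comm]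
  simp [oneVec, path, pathAB, pathB]

lemma eval_leftOp (g : GenA m) (n : NF m) : eval q (leftOp q g n) = gE k m q g * path q n := by
  have he v (h : source n ≠ v) : gE k m q (.e v) * path q n = 0 :=
    mul_path_of_ne q (by simp [e_mul_e]) h
  have ha v (h : source n ≠ some (v + 1)) := mul_path_of_ne q (a_mul_e q v) h
  have hb v (h : source n ≠ some v) := mul_path_of_ne q (b_mul_e q v) h
  have hc v (h : source n ≠ none) := mul_path_of_ne q (c_mul_e q v) h
  have hs := e_mul_path q n
  rcases g with (_ | v) | v | v | v <;> rcases n with ⟨i, s, t⟩ | ⟨i, s⟩ | _ <;>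
    simp only [leftOp, source] at * <;> (try split_ifs) <;>
    simp_all [path, pathAB, pathAC, b_mul_pathAB]
  · rcases eq_or_ne i v with rfl | h
    · exact (b_mul_pathAC q i s).symm
    · exact (hb v h).symm
  · exact (c_mul_e q v).symm

lemma eval_rep (x : EΓ k m q) (v : NF m →₀ k) : eval q (rep q x v) = x * eval q v := by
  induction x using EΓ_induction generalizing v with
  | halg r => simp [Algebra.algebraMap_eq_smul_one]
  | hgen g =>
    rw [rep_gE]
    induction v using Finsupp.induction_linear with
    | zero => simp
    | add v w hv hw => simp [mul_add, hv, hw]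
    | single n r => simp [eval_leftOp]
  | hmul x y hx hy => simp [hx, hy, mul_assoc]
  | hadd x y hx hy => simp [hx, hy, add_mul]

/-- The normal form of an element. -/
noncomputable def nf (x : EΓ k m q) : NF m →₀ k := rep q x oneVec

lemma eval_nf (x : EΓ k m q) : eval q (nf q x) = x := by
  rw [nf, eval_rep, eval_oneVec, mul_one]

lemma nf_mul (x y : EΓ k m q) : nf q (x * y) = rep q x (nf q y) := by simp [nf]

lemma nf_mul_a (x : EΓ k m q) (j : ZMod m) :
    nf q (x * gE k m q (.a j)) = Finsupp.linearCombination k (rightA q j) (nf q x) := by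
  have h : nf q (gE k m q (.a j)) = Finsupp.linearCombination k (rightA q j) oneVec := by
    simp [nf, oneVec, leftOp, rightA, coef]
  rw [nf_mul, h]
  exact LinearMap.congr_fun (commute_rep q _ (commute_rightA q j) x) oneVec

lemma nf_mul_c (x : EΓ k m q) (j : ZMod m) :
    nf q (x * gE k m q (.c j)) = Finsupp.linearCombination k (rightC j) (nf q x) := by
  have h : nf q (gE k m q (.c j)) = Finsupp.linearCombination k (rightC j) oneVec := by
    simp [nf, oneVec, leftOp, rightC]
  rw [nf_mul, h]
  exact LinearMap.congr_fun (commute_rep q _ (commute_rightC q j) x) oneVec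

/-- The coordinate at the idempotent `e_{−1}` vanishes on elements of positive length. -/
lemma nf_pt_of_mem_HboxA {l : ℕ} (hl : l ≠ 0) {x : EΓ k m q} (hx : x ∈ HboxA k m q l) :
    nf q x .pt = 0 := by
  induction hx using Submodule.span_induction with
  | mem x hx =>
    obtain ⟨v, _ | ⟨p, L⟩, hL, rfl⟩ := hx
    · exact absurd hL.symm hl
    rw [List.map_cons, List.prod_cons, nf_mul, nf_mul, rep_gE, rep_gE]
    rw [leftEnd_e_pt, leftEnd_arrA_pt, ite_self]
  | zero => simp [nf]
  | add x y _ _ hx hy =>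
    simp only [nf, map_add, LinearMap.add_apply, Finsupp.add_apply] at hx hy ⊢
    simp [hx, hy]
  | smul r x _ hx =>
    simp only [nf, map_smul, LinearMap.smul_apply, Finsupp.smul_apply] at hx ⊢
    simp [hx]

/-- A cyclic family whose consecutive ratios multiply to something other than `1` vanishes. -/
lemma eq_zero_of_cyclic {f g : ZMod m → k} (h : ∀ i, f (i + 1) = g i * f i)
    (hg : ∏ i, g i ≠ 1) (i : ZMod m) : f i = 0 := by
  by_contra hi
  have hprod : ∏ i, f i = (∏ i, g i) * ∏ i, f i := by
    rw [← Finset.prod_mul_distrib, ← Finset.prod_congr rfl fun i _ => h i]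
    exact (Equiv.prod_comp (Equiv.addRight (1 : ZMod m)) f).symm
  by_cases h0 : ∏ i, f i = 0
  · obtain ⟨j, -, hj⟩ := Finset.prod_eq_zero_iff.1 h0
    have key (n : ℕ) : f (j + n) = 0 := by
      induction n with
      | zero => simpa using hj
      | succ n ih => rw [Nat.cast_succ, ← add_assoc, h, ih, mul_zero]
    exact hi (by simpa using key (i - j).val)
  · exact hg (mul_right_cancel₀ h0 (by rw [one_mul, ← hprod]))

lemma oneVec_ab (i : ZMod m) (s t : ℕ) :
    (oneVec : NF m →₀ k) (.ab i s t) = if s = 0 ∧ t = 0 then 1 else 0 := by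
  simp only [oneVec, Finsupp.add_apply, Finsupp.finsetSum_apply, Finsupp.single_apply]
  by_cases h : s = 0 ∧ t = 0
  · simp [h]
  · have h' : ¬(0 = s ∧ 0 = t) := by omega
    simp [h, h']

lemma prod_sign_coef_ne_one {t : ℕ} (ht : t ≠ 0) {ε : k} (hε : ε ^ 2 = 1)
    (hζ : ∀ r : ℕ, 1 ≤ r → (∏ i : ZMod m, q i) ^ r ≠ 1) : ∏ i, ε * coef q i t ≠ 1 := by
  intro h
  rw [Finset.prod_mul_distrib, prod_coef, Finset.prod_const, Finset.card_univ, ZMod.card] at h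
  refine hζ (t * 2) (by omega) (inv_injective ?_)
  have h2 := congrArg (fun x => x ^ 2) h
  rw [mul_pow, ← pow_mul, mul_comm m, pow_mul, hε, one_pow, one_mul, mul_pow, mul_pow,
    ← pow_mul, ← pow_mul, ← pow_mul, mul_comm m, mul_comm t, mul_assoc, pow_mul (-1 : k),
    neg_one_sq, one_pow, one_mul, one_pow] at h2
  rw [← inv_pow, mul_comm, h2, inv_one]

/-- An element commuting up to the sign `ε` with the arrows `a_j` and `c_j` is a scalar, provided
its coordinate at `e_{−1}` vanishes or `ε = 1`. -/
lemma eq_smul_one_of_commute (hζ : ∀ r : ℕ, 1 ≤ r → (∏ i : ZMod m, q i) ^ r ≠ 1) {ε : k}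
    (hε : ε ^ 2 = 1) {z : EΓ k m q} (hpt : nf q z .pt = 0 ∨ ε = 1)
    (hA : ∀ j, z * gE k m q (.a j) = ε • (gE k m q (.a j) * z))
    (hC : ∀ j, z * gE k m q (.c j) = ε • (gE k m q (.c j) * z)) :
    z = nf q z .pt • 1 := by
  have hε0 : ε ≠ 0 := by rintro rfl; simp at hε
  have nf_smul (x : EΓ k m q) : nf q (ε • x) = ε • nf q x := by simp [nf]
  have hA' j n : Finsupp.linearCombination k (rightA q j) (nf q z) n =
      ε * leftEnd q (.a j) (nf q z) n := by
    rw [← nf_mul_a, hA, nf_smul, nf_mul, rep_gE, Finsupp.smul_apply, smul_eq_mul]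
  have hC' j n : Finsupp.linearCombination k (rightC j) (nf q z) n =
      ε * leftEnd q (.c j) (nf q z) n := by
    rw [← nf_mul_c, hC, nf_smul, nf_mul, rep_gE, Finsupp.smul_apply, smul_eq_mul]
  have hac (i : ZMod m) (s : ℕ) : nf q z (.ac i s) = 0 := by
    have h := hA' (i - 1) (.ac (i - 1) (s + 1))
    rw [rightA_ac, leftEnd_a_ac, sub_add_cancel] at h
    simpa [hε0] using h.symm
  have hstep (i : ZMod m) (s t : ℕ) : ε * nf q z (.ab (i + 1) s t) =
      if (s : ZMod m) = t then coef q i t * nf q z (.ab i s t) else 0 := by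
    rw [← rightA_ab, hA', leftEnd_a_ab]
  have hab0 (i : ZMod m) (s : ℕ) :
      nf q z (.ab i s 0) = if s = 0 then ε * nf q z .pt else 0 := by
    have h := hC' (i + s) (.ac i s)
    rw [rightC_ac, leftEnd_c_ac] at h
    rw [h]
    by_cases hs : s = 0 <;> simp [hs]
  have hab (i : ZMod m) (s t : ℕ) (ht : t ≠ 0) : nf q z (.ab i s t) = 0 := by
    by_cases hst : (s : ZMod m) = t
    · refine eq_zero_of_cyclic (f := fun i => nf q z (.ab i s t)) (g := fun i => ε * coef q i t)
        (fun i => ?_) (prod_sign_coef_ne_one q ht hε hζ) i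
      have h := hstep i s t
      rw [if_pos hst] at h
      rw [mul_assoc, ← h, ← mul_assoc, ← sq, hε, one_mul]
    · have h := hstep (i - 1) s t
      rw [if_neg hst, sub_add_cancel] at h
      simpa [hε0] using h
  have hnf : nf q z = nf q z .pt • oneVec := by
    ext n
    rcases n with ⟨i, s, _ | t⟩ | ⟨i, s⟩ | _
    · rw [hab0, Finsupp.smul_apply, oneVec_ab]
      rcases hpt with h | h <;> simp [h]
    · simp [hab, oneVec_ab]
    · simp [hac, oneVec]
    · simp [oneVec]
  calc z = eval q (nf q z) := (eval_nf q z).symm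
    _ = nf q z .pt • 1 := by rw [hnf, map_smul, eval_oneVec]; simp [oneVec]

lemma gE_a_mem (j : ZMod m) : gE k m q (.a j) ∈ HboxA k m q 1 :=
  Submodule.subset_span ⟨some j, [(j, 0)], rfl, by simp [arrA, e_mul_a]⟩

lemma gE_c_mem (j : ZMod m) : gE k m q (.c j) ∈ HboxA k m q 1 :=
  Submodule.subset_span ⟨some j, [(j, 2)], rfl, by simp [arrA, e_mul_c]⟩

end

end KoszulDual

/-- If `ζ = q₀ q₁ ⋯ q_{m−1}` is not a root of unity in `k`, then the graded
centre `Z_gr(E(Γ_q))` equals `k` (the scalars). -/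
theorem stmt_2 (k : Type) [Field k] (m : ℕ) [NeZero m] (hm : 2 ≤ m)
    (q : ZMod m → k) (hq : ∀ i, q i ≠ 0)
    (hζ : ∀ r : ℕ, 1 ≤ r → (∏ i : ZMod m, q i) ^ r ≠ 1) :
    ZgrA k m q = ⊥ := by
  refine le_antisymm (Algebra.adjoin_le ?_) bot_le
  rintro z ⟨l, hz, hcomm⟩
  have hz' := KoszulDual.eq_smul_one_of_commute q hζ (ε := (-1) ^ l) (by simp [← pow_mul'])
    (z := z) ?_ (fun j => by simpa using hcomm 1 _ (KoszulDual.gE_a_mem q j))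
    (fun j => by simpa using hcomm 1 _ (KoszulDual.gE_c_mem q j))
  · rw [hz', ← Algebra.algebraMap_eq_smul_one]
    exact Subalgebra.algebraMap_mem _ _
  · rcases eq_or_ne l 0 with rfl | hl
    · exact .inr (pow_zero _)
    · exact .inl (KoszulDual.nf_pt_of_mem_HboxA q hl hz)
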